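/- arXiv:1901.07823 — 8 statements merged into one kernel-verified Lean document; each statement's English description precedes it below -/
import Mathlib

section
/- Let B be a biregular bipartite graph with K left vertices each of degree D ≥ 1 and with every right vertex of degree E, where 1 ≤ E ≤ K. Then there exist distinct left vertices k_1, k_2, …, k_E such that, defining ρ_j to be the set of right vertices adjacent to every one of k_1, …, k_j, one has |ρ_1| = D and, for every j with 2 ≤ j ≤ E, |ρ_j| ≥ ⌈(E − j + 1)·|ρ_{j−1}| / (K − j + 1)⌉. -/
/-- For a bipartite graph given by left-neighborhoods `N`, a sequence of left vertices
`k`, and `j : ℕ`, `rho N k j` is the set of right vertices adjacent to every one of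
`k 0, …, k (j-1)` (the first `j` chosen left vertices). -/
def rho {α β : Type*} [Fintype β] [DecidableEq β] {E : ℕ} (N : α → Finset β)
    (k : Fin E → α) (j : ℕ) : Finset β :=
  Finset.univ.filter (fun b => ∀ i : Fin E, (i : ℕ) < j → b ∈ N (k i))

open Finset in
theorem step_aux {α β : Type*} [Fintype α] [Fintype β] [DecidableEq α] [DecidableEq β]
    (K E : ℕ) (hKcard : Fintype.card α = K) (N : α → Finset β)
    (hE : ∀ b : β, (Finset.univ.filter (fun a => b ∈ N a)).card = E)
    (S : Finset α) (hS : S.card < K) (T : Finset β) (hT : ∀ b ∈ T, ∀ a ∈ S, b ∈ N a) :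
    ∃ a, a ∉ S ∧ ((E : ℚ) - S.card) * T.card ≤ ((K : ℚ) - S.card) * (T ∩ N a).card := by
  by_contra! hcon
  have hc : ((Sᶜ.card : ℕ) : ℚ) = (K : ℚ) - S.card := by
    rw [card_compl, hKcard, Nat.cast_sub hS.le]
  have hpos : (0 : ℚ) < (K : ℚ) - S.card := by
    have : (S.card : ℚ) < K := by exact_mod_cast hS
    linarith
  have hne : (Sᶜ).Nonempty := by
    rw [← card_pos]
    have : (0 : ℚ) < ((Sᶜ.card : ℕ) : ℚ) := by rw [hc]; exact hpos
    exact_mod_cast this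
  have h1 : ∑ a ∈ Sᶜ, ((K : ℚ) - S.card) * (T ∩ N a).card
      < ∑ a ∈ Sᶜ, ((E : ℚ) - S.card) * T.card :=
    sum_lt_sum_of_nonempty hne (fun a ha => hcon a (by simpa using ha))
  have h2 : ∑ a ∈ Sᶜ, ((T ∩ N a).card : ℚ) = ((E : ℚ) - S.card) * T.card := by
    have h3 : ∑ a ∈ Sᶜ, ((T ∩ N a).card : ℚ)
        = ∑ b ∈ T, ((Sᶜ.filter (fun a => b ∈ N a)).card : ℚ) := by
      have := sum_card_bipartiteAbove_eq_sum_card_bipartiteBelow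
        (s := Sᶜ) (t := T) (fun a b => b ∈ N a)
      simp only [bipartiteAbove, bipartiteBelow, filter_mem_eq_inter] at this
      exact_mod_cast this
    rw [h3, sum_congr rfl (g := fun _ => (E : ℚ) - S.card)]
    · rw [sum_const, nsmul_eq_mul, mul_comm]
    · intro b hb
      have h4 : Sᶜ.filter (fun a => b ∈ N a) = (univ.filter (fun a => b ∈ N a)) \ S := by
        ext a; simp [and_comm]
      have h5 : S ⊆ univ.filter (fun a => b ∈ N a) := by
        intro a ha; simpa using hT b hb a ha
      rw [h4, card_sdiff_of_subset h5, Nat.cast_sub (card_le_card h5), hE]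
  rw [← mul_sum, h2, sum_const, nsmul_eq_mul, hc] at h1
  exact lt_irrefl _ h1

open Finset in
theorem seq_aux {α β : Type*} [Fintype α] [Fintype β] [DecidableEq α] [DecidableEq β]
    (K E : ℕ) (hKcard : Fintype.card α = K) (N : α → Finset β)
    (hE : ∀ b : β, (Finset.univ.filter (fun a => b ∈ N a)).card = E)
    (hK1 : 1 ≤ K) (m : ℕ) (hm : m ≤ K) :
    ∃ k : ℕ → α, (∀ i < m, ∀ j < m, k i = k j → i = j) ∧
      ∀ j < m, ((E : ℚ) - j) * (univ.filter (fun b => ∀ i < j, b ∈ N (k i))).card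
        ≤ ((K : ℚ) - j) * (univ.filter (fun b => ∀ i < j + 1, b ∈ N (k i))).card := by
  induction m with
  | zero =>
    have : Nonempty α := Fintype.card_pos_iff.mp (by omega)
    exact ⟨fun _ => Classical.arbitrary α, by simp, by simp⟩
  | succ m ih =>
    obtain ⟨k, hk, hj⟩ := ih (by omega)
    have hcard : ((range m).image k).card = m := by
      rw [card_image_of_injOn, card_range]
      intro i hi j hj' h
      exact hk i (by simpa using hi) j (by simpa using hj') h
    obtain ⟨a, ha, hle⟩ := step_aux K E hKcard N hE ((range m).image k) (by omega)
      (univ.filter (fun b => ∀ i < m, b ∈ N (k i))) (by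
        intro b hb a ha
        simp only [mem_filter, mem_univ, true_and] at hb
        obtain ⟨i, hi, rfl⟩ := mem_image.mp ha
        exact hb i (by simpa using hi))
    rw [hcard] at hle
    have hne : ∀ i < m, k i ≠ a := fun i hi h =>
      ha (mem_image.mpr ⟨i, by simpa using hi, h⟩)
    have hu : ∀ i < m, Function.update k m a i = k i := fun i hi =>
      Function.update_of_ne (by omega) _ _
    have hum : Function.update k m a m = a := Function.update_self _ _ _
    have hR : ∀ j ≤ m, (univ.filter (fun b => ∀ i < j, b ∈ N (Function.update k m a i)))
        = univ.filter (fun b => ∀ i < j, b ∈ N (k i)) := by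
      intro j hjm
      refine filter_congr fun b _ => forall₂_congr fun i hi => ?_
      rw [hu i (by omega)]
    refine ⟨Function.update k m a, ?_, ?_⟩
    · intro i hi j hj' h
      rcases Nat.lt_succ_iff_lt_or_eq.mp hi with hi | rfl <;>
        rcases Nat.lt_succ_iff_lt_or_eq.mp hj' with hj' | rfl
      · rw [hu i hi, hu j hj'] at h; exact hk i hi j hj' h
      · rw [hu i hi, hum] at h; exact absurd h (hne i hi)
      · rw [hu j hj', hum] at h; exact absurd h.symm (hne j hj')
      · rfl
    · intro j hjm
      rcases Nat.lt_succ_iff_lt_or_eq.mp hjm with hlt | rfl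
      · rw [hR j hlt.le, hR (j + 1) hlt]; exact hj j hlt
      · rw [hR j le_rfl]
        convert hle using 4
        ext b
        simp only [mem_filter, mem_univ, true_and, mem_inter, Nat.forall_lt_succ_right, hum]
        refine and_congr_left fun _ => forall₂_congr fun i hi => ?_
        rw [hu i hi]

/-- For a biregular bipartite graph with `K` left vertices each of degree `D ≥ 1` and every
right vertex of degree `E`, `1 ≤ E ≤ K`, there exist distinct left vertices `k_1, …, k_E`
with `|ρ_1| = D` and `|ρ_j| ≥ ⌈(E − j + 1)·|ρ_{j−1}| / (K − j + 1)⌉` for `2 ≤ j ≤ E`. -/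
theorem stmt1 {α β : Type*} [Fintype α] [Fintype β] [DecidableEq α] [DecidableEq β]
    (K D E : ℕ) (hKcard : Fintype.card α = K)
    (N : α → Finset β)
    (hD : ∀ a : α, (N a).card = D) (hD1 : 1 ≤ D)
    (hE : ∀ b : β, (Finset.univ.filter (fun a => b ∈ N a)).card = E)
    (hE1 : 1 ≤ E) (hEK : E ≤ K) :
    ∃ k : Fin E → α, Function.Injective k ∧
      (rho N k 1).card = D ∧
      ∀ j : ℕ, 2 ≤ j → j ≤ E →
        ⌈(((E : ℚ) - j + 1) * ((rho N k (j - 1)).card : ℚ)) / ((K : ℚ) - j + 1)⌉₊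
          ≤ (rho N k j).card := by
  obtain ⟨k, hk, hj⟩ := seq_aux K E hKcard N hE (by omega) E hEK
  have hrho : ∀ j ≤ E, rho N (fun i : Fin E => k i) j
      = Finset.univ.filter (fun b => ∀ i < j, b ∈ N (k i)) := by
    intro j hjE
    ext b
    simp only [rho, Finset.mem_filter, Finset.mem_univ, true_and]
    exact ⟨fun h i hi => h ⟨i, by omega⟩ hi, fun h i hi => h i hi⟩
  refine ⟨fun i => k i, fun i j h => Fin.ext (hk i i.2 j j.2 h), ?_, ?_⟩
  · rw [hrho 1 hE1, ← hD (k 0)]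
    congr 1
    ext b
    simp
  · intro j h2 hjE
    obtain ⟨m, rfl⟩ : ∃ m, j = m + 1 := ⟨j - 1, by omega⟩
    rw [hrho _ hjE, Nat.add_sub_cancel, hrho m (by omega)]
    have h := hj m (by omega)
    have hpos : (0 : ℚ) < (K : ℚ) - m := by
      have : (m : ℚ) < K := by exact_mod_cast (by omega : m < K)
      linarith
    rw [Nat.ceil_le]
    push_cast
    rw [show (E : ℚ) - (m + 1) + 1 = E - m by ring, show (K : ℚ) - (m + 1) + 1 = K - m by ring,
      div_le_iff₀ hpos, mul_comm _ ((K : ℚ) - m)]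
    exact h
end

section
/- Fix a subspace V ∈ 𝕍. Then the number of sets X ∈ 𝕏 such that V is not contained in the sum Σ_{V_i ∈ X} V_i equals [k−t choose m+1]_q · q^{m+1} · ∏_{i=0}^{m}(q^{m+1} − q^{i}) / ((q−1)^{m+1} (m+1)!). -/
/-- The `q`-binomial coefficient `[a choose b]_q = ∏_{i=0}^{b−1} (q^{a−i} − 1)/(q^{b−i} − 1)`,
as a rational number. -/
def qBinomQ (q a b : ℕ) : ℚ :=
  ∏ i ∈ Finset.range b, ((q : ℚ) ^ (a - i) - 1) / ((q : ℚ) ^ (b - i) - 1)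

open Module Submodule
set_option linter.unusedSectionVars false
theorem aux_fib {A B : Type*} [Finite A] [Finite B] (φ : A → B) (n : ℕ)
    (h : ∀ b, Nat.card {a // φ a = b} = n) : Nat.card A = Nat.card B * n := by
  classical
  have := Fintype.ofFinite B
  rw [Nat.card_congr (Equiv.sigmaFiberEquiv φ).symm, Nat.card_sigma]
  simp [h]

section
variable {F E : Type*} [Field F] [Finite F] [AddCommGroup E] [Module F E] [Finite E]

theorem aux_cardA (V₀ : Submodule F E) (n : ℕ) :
    Nat.card {v : Fin n → E // LinearIndependent F (fun i => V₀.mkQ (v i))} =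
    Nat.card {w : Fin n → E ⧸ V₀ // LinearIndependent F w} * (Nat.card V₀) ^ n := by
  have : Finite (E ⧸ V₀) := Quotient.finite _
  apply aux_fib (fun v => ⟨fun i => V₀.mkQ (v.1 i), v.2⟩)
  rintro ⟨w, hw⟩
  choose x hx using fun i => V₀.mkQ_surjective (w i)
  have e : (Fin n → V₀) ≃ {a : {v : Fin n → E // LinearIndependent F (fun i => V₀.mkQ (v i))} //
      (⟨fun i => V₀.mkQ (a.1 i), a.2⟩ : {w : Fin n → E ⧸ V₀ // LinearIndependent F w}) = ⟨w, hw⟩} := by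
    have key : ∀ u : Fin n → V₀, (fun i => V₀.mkQ (x i + (u i : E))) = w := by
      intro u
      funext i
      rw [map_add, hx]
      simp
    refine Equiv.ofBijective (fun u => ⟨⟨fun i => x i + u i, ?_⟩, ?_⟩) ⟨?_, ?_⟩
    · rw [key]; exact hw
    · exact Subtype.ext (key u)
    · intro u u' h
      have h := congrArg (fun z => z.1.1) h
      funext i
      have := congrFun h i
      exact Subtype.ext (by simpa using this)
    · rintro ⟨⟨v, hv⟩, h⟩
      have h : (fun i => V₀.mkQ (v i)) = w := congrArg Subtype.val h
      refine ⟨fun i => ⟨v i - x i, ?_⟩, ?_⟩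
      · have : V₀.mkQ (v i) = V₀.mkQ (x i) := (congrFun h i).trans (hx i).symm
        exact (Submodule.Quotient.eq V₀).1 this
      · apply Subtype.ext
        apply Subtype.ext
        funext i
        simp
  rw [← Nat.card_congr e, Nat.card_pi]
  simp

theorem aux_cardDiff (V W : Submodule F E) (h : W ≤ V) :
    Nat.card {x : E // x ∈ V ∧ x ∉ W} = Nat.card V - Nat.card W := by
  have : Nat.card {x : E // x ∈ V ∧ x ∉ W} = ((V : Set E) \ (W : Set E)).ncard := rfl
  rw [this, Set.ncard_sdiff (by exact_mod_cast h) (Set.toFinite _)]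
  rfl

theorem aux_sup (W : Submodule F E) (t : ℕ) (ht : 1 ≤ t) (hW : finrank F W = t - 1)
    (V : Submodule F E) (hV : finrank F V = t) (hWV : W ≤ V) (x : E) (hx : x ∈ V) (hxW : x ∉ W) :
    W ⊔ span F {x} = V := by
  apply Submodule.eq_of_le_of_finrank_le
  · exact sup_le hWV (by simpa using hx)
  · have : W < W ⊔ span F {x} := by
      refine lt_of_le_of_ne le_sup_left fun h => hxW ?_
      rw [h]
      exact mem_sup_right (mem_span_singleton_self x)
    have := Submodule.finrank_lt_finrank_of_lt this
    omega

theorem aux_dim (W : Submodule F E) (t : ℕ) (ht : 1 ≤ t) (hW : finrank F W = t - 1)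
    (x : E) (hxW : x ∉ W) : finrank F ↥(W ⊔ span F {x}) = t := by
  have h1 : W < W ⊔ span F {x} := by
    refine lt_of_le_of_ne le_sup_left fun h => hxW ?_
    rw [h]
    exact mem_sup_right (mem_span_singleton_self x)
  have := Submodule.finrank_lt_finrank_of_lt h1
  have h2 := Submodule.finrank_add_le_finrank_add_finrank W (span F {x})
  have h3 : finrank F (span F {x}) ≤ 1 := by
    simpa using finrank_span_le_card (R := F) ({x} : Set E)
  omega

theorem aux_map (V₀ S : Submodule F E) :
    finrank F (S.map V₀.mkQ) + finrank F V₀ = finrank F ↥(S ⊔ V₀) := by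
  have := Submodule.finrank_quotient_add_finrank (Submodule.comap (S ⊔ V₀).subtype V₀)
  have h1 := (Submodule.comapSubtypeEquivOfLe (p := V₀) (q := S ⊔ V₀) le_sup_right).finrank_eq
  have h3 := LinearMap.finrank_range_add_finrank_ker (V₀.mkQ.domRestrict (S ⊔ V₀))
  rw [LinearMap.range_domRestrict, LinearMap.ker_domRestrict, ker_mkQ, Submodule.map_sup] at h3
  have h4 : V₀.map V₀.mkQ = ⊥ := by
    rw [eq_bot_iff, Submodule.map_le_iff_le_comap]
    simp
  rw [h4, sup_bot_eq] at h3
  rw [← h3]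
  congr 1
  exact h1.symm

/-- main linear algebra -/
theorem aux_iff (W V₀ : Submodule F E) (t m : ℕ) (ht : 1 ≤ t) (hW : finrank F W = t - 1)
    (hV₀ : finrank F V₀ = t) (hWV : W ≤ V₀) (v : Fin (m+1) → E) :
    LinearIndependent F (fun i => V₀.mkQ (v i)) ↔
      finrank F ↥(W ⊔ span F (Set.range v)) = m + t ∧ ¬ V₀ ≤ W ⊔ span F (Set.range v) := by
  rw [linearIndependent_iff_card_eq_finrank_span]
  set S := W ⊔ span F (Set.range v) with hS
  have e : span F (Set.range (fun i => V₀.mkQ (v i))) = S.map V₀.mkQ := by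
    rw [hS, Submodule.map_sup, Submodule.map_span, ← Set.range_comp]
    have : W.map V₀.mkQ = ⊥ := by
      rw [eq_bot_iff, Submodule.map_le_iff_le_comap]
      exact hWV.trans (by simp)
    rw [this, bot_sup_eq]; rfl
  have h1 := aux_map V₀ S
  have h2 := Submodule.finrank_sup_add_finrank_inf_eq S V₀
  have h3 : finrank F W ≤ finrank F ↥(S ⊓ V₀) := Submodule.finrank_mono (le_inf le_sup_left hWV)
  have h4 := Submodule.finrank_add_le_finrank_add_finrank W (span F (Set.range v))
  have h5 := finrank_range_le_card (R := F) v
  rw [Set.finrank] at h5 ⊢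
  rw [e]
  simp only [Fintype.card_fin] at *
  rw [← hS] at h4
  constructor
  · intro h
    refine ⟨by omega, fun hle => ?_⟩
    rw [sup_eq_left.2 hle] at h1
    omega
  · rintro ⟨h, hn⟩
    have : S ⊓ V₀ < V₀ := lt_of_le_of_ne inf_le_right (fun h => hn (by rw [← h]; exact inf_le_left))
    have := Submodule.finrank_lt_finrank_of_lt this
    omega

theorem aux_inj (W V₀ : Submodule F E) (hWV : W ≤ V₀) {n : ℕ} (v : Fin n → E)
    (h : LinearIndependent F (fun i => V₀.mkQ (v i))) :
    Function.Injective (fun i => W ⊔ span F {v i}) := by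
  intro i j hij
  by_contra hne
  have hmem : v j ∈ W ⊔ span F {v i} := by
    have : W ⊔ span F {v i} = W ⊔ span F {v j} := hij
    rw [this]; exact mem_sup_right (mem_span_singleton_self _)
  obtain ⟨w, hw, y, hy, hwy⟩ := Submodule.mem_sup.1 hmem
  obtain ⟨c, rfl⟩ := Submodule.mem_span_singleton.1 hy
  have h0 : V₀.mkQ w = 0 := by simpa using hWV hw
  have h1 := (LinearIndependent.notMem_span_image h (s := {i}) (x := j) (by simpa using Ne.symm hne))
  apply h1
  simp only [Set.image_singleton]
  rw [← hwy, map_add, h0, zero_add, map_smul]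
  exact Submodule.smul_mem _ _ (mem_span_singleton_self _)

theorem aux_notMem (W V₀ : Submodule F E) (hWV : W ≤ V₀) {n : ℕ} (v : Fin n → E)
    (h : LinearIndependent F (fun i => V₀.mkQ (v i))) (i : Fin n) : v i ∉ W := by
  intro hi
  exact h.ne_zero i (by simpa using hWV hi)

def PB (W V₀ : Submodule F E) (t m : ℕ) (f : Fin (m+1) → Submodule F E) : Prop :=
  Function.Injective f ∧ (∀ i, finrank F ↥(f i) = t ∧ W ≤ f i) ∧ finrank F ↥(⨆ i, f i) = m + t ∧
    ¬ V₀ ≤ ⨆ i, f i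

abbrev TB (W V₀ : Submodule F E) (t m : ℕ) := {f : Fin (m+1) → Submodule F E // PB W V₀ t m f}

abbrev TA (V₀ : Submodule F E) (m : ℕ) :=
  {v : Fin (m+1) → E // LinearIndependent F (fun i => V₀.mkQ (v i))}

def PC (W V₀ : Submodule F E) (t m : ℕ) (X : Finset (Submodule F E)) : Prop :=
  (X.card = m + 1 ∧ (∀ V ∈ X, Module.finrank F ↥V = t ∧ W ≤ V) ∧
          Module.finrank F ↥(X.sup id) = m + t) ∧
        ¬ V₀ ≤ X.sup id

theorem aux_iSup (W : Submodule F E) (m : ℕ) (v : Fin (m+1) → E) :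
    ⨆ i, (W ⊔ span F {v i}) = W ⊔ span F (Set.range v) := by
  rw [← sup_iSup, ← Submodule.span_range_eq_iSup]

theorem aux_AB (W V₀ : Submodule F E) (t m : ℕ) (ht : 1 ≤ t) (hW : finrank F W = t - 1)
    (hV₀ : finrank F V₀ = t) (hWV : W ≤ V₀) :
    Nat.card {v : Fin (m+1) → E // LinearIndependent F (fun i => V₀.mkQ (v i))} =
    Nat.card (TB W V₀ t m) * (Nat.card F ^ t - Nat.card F ^ (t-1)) ^ (m+1) := by
  have : Finite (Submodule F E) := Finite.of_injective _ SetLike.coe_injective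
  have hφ : ∀ v : TA V₀ m, PB W V₀ t m (fun i => W ⊔ span F {v.1 i}) := by
    intro v
    unfold PB
    rw [aux_iSup]
    exact ⟨aux_inj W V₀ hWV v.1 v.2,
      fun i => ⟨aux_dim W t ht hW _ (aux_notMem W V₀ hWV v.1 v.2 i), le_sup_left⟩,
      (aux_iff W V₀ t m ht hW hV₀ hWV v.1).1 v.2⟩
  refine aux_fib (A := TA V₀ m) (B := TB W V₀ t m) (fun v => ⟨fun i => W ⊔ span F {v.1 i}, hφ v⟩) _ ?_
  rintro ⟨f, hf⟩
  have e : (∀ i, {x : E // x ∈ f i ∧ x ∉ W}) ≃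
      {a // (fun v : TA V₀ m =>
        (⟨fun i => W ⊔ span F {v.1 i}, hφ v⟩ : TB W V₀ t m)) a = ⟨f, hf⟩} := by
    have key : ∀ u : (∀ i, {x : E // x ∈ f i ∧ x ∉ W}),
        (fun i => W ⊔ span F {(u i).1}) = f := fun u => funext fun i =>
      aux_sup W t ht hW (f i) (hf.2.1 i).1 (hf.2.1 i).2 _ (u i).2.1 (u i).2.2
    refine Equiv.ofBijective (fun u => ⟨⟨fun i => (u i).1, ?_⟩, ?_⟩) ⟨?_, ?_⟩
    · rw [aux_iff W V₀ t m ht hW hV₀ hWV, ← aux_iSup]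
      have h2 : ⨆ i, (W ⊔ span F {(u i).1}) = ⨆ i, f i :=
        congrArg iSup (key u)
      rw [h2]
      exact hf.2.2
    · exact Subtype.ext (key u)
    · intro u u' h
      have h := congrArg (fun z => z.1.1) h
      funext i
      exact Subtype.ext (congrFun h i)
    · rintro ⟨⟨v, hv⟩, h⟩
      have h : (fun i => W ⊔ span F {v i}) = f := congrArg Subtype.val h
      refine ⟨fun i => ⟨v i, ?_, aux_notMem W V₀ hWV v hv i⟩, rfl⟩
      rw [← h]
      exact mem_sup_right (mem_span_singleton_self _)
  rw [← Nat.card_congr e, Nat.card_pi]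
  have : ∀ i, Nat.card {x : E // x ∈ f i ∧ x ∉ W} = Nat.card F ^ t - Nat.card F ^ (t-1) := by
    intro i
    rw [aux_cardDiff _ _ (hf.2.1 i).2, Module.natCard_eq_pow_finrank (K := F) (V := W),
      Module.natCard_eq_pow_finrank (K := F) (V := f i), hW, (hf.2.1 i).1]
  simp [this]

theorem aux_BC (W V₀ : Submodule F E) (t m : ℕ) :
    Nat.card (TB W V₀ t m) =
    Nat.card {X : Finset (Submodule F E) // PC W V₀ t m X} * (m+1).factorial := by
  classical
  have : Finite (Submodule F E) := Finite.of_injective _ SetLike.coe_injective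
  have hs : ∀ f : Fin (m+1) → Submodule F E, (Finset.univ.image f).sup id = ⨆ i, f i := by
    intro f
    rw [Finset.sup_image, Finset.sup_univ_eq_iSup]; rfl
  have hφ : ∀ f : TB W V₀ t m, PC W V₀ t m (Finset.univ.image f.1) := by
    intro f
    unfold PC
    rw [hs]
    refine ⟨⟨?_, ?_, f.2.2.2.1⟩, f.2.2.2.2⟩
    · rw [Finset.card_image_of_injective _ f.2.1]; simp
    · simpa using f.2.2.1
  refine aux_fib (A := TB W V₀ t m) (B := {X : Finset (Submodule F E) // PC W V₀ t m X})
    (fun f => ⟨Finset.univ.image f.1, hφ f⟩) _ ?_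
  rintro ⟨X, hX⟩
  have key : ∀ e : Fin (m+1) ≃ X, Finset.univ.image (fun i => (e i : Submodule F E)) = X := by
    intro e
    ext V
    simp only [Finset.mem_image, Finset.mem_univ, true_and]
    constructor
    · rintro ⟨i, rfl⟩; exact (e i).2
    · intro h; exact ⟨e.symm ⟨V, h⟩, by simp⟩
  have hc : Nat.card (Fin (m+1) ≃ X) = (m+1).factorial := by
    have e0 : Fin (m+1) ≃ X := (Finset.equivFinOfCardEq hX.1.1).symm
    rw [Nat.card_eq_fintype_card, Fintype.card_equiv e0]; simp
  rw [← hc]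
  symm
  refine Nat.card_congr (Equiv.ofBijective (fun e => ⟨⟨fun i => (e i : Submodule F E), ?_, ?_, ?_⟩, ?_⟩) ⟨?_, ?_⟩)
  · exact Subtype.val_injective.comp e.injective
  · exact fun i => hX.1.2.1 _ (e i).2
  · rw [← hs, key]; exact ⟨hX.1.2.2, hX.2⟩
  · exact Subtype.ext (key e)
  · intro e e' h
    have h := congrArg (fun z => z.1.1) h
    ext i
    exact congrArg (fun z => _ ∈ z) (congrFun h i) |>.to_iff
  · rintro ⟨⟨f, hf⟩, h⟩
    have h : Finset.univ.image f = X := congrArg Subtype.val h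
    subst h
    refine ⟨Equiv.ofBijective (fun i => ⟨f i, by simp⟩) ⟨?_, ?_⟩, rfl⟩
    · intro i j hij
      exact hf.1 (congrArg Subtype.val hij)
    · rintro ⟨V, hV⟩
      obtain ⟨i, -, rfl⟩ := Finset.mem_image.1 hV
      exact ⟨i, rfl⟩
end


theorem aux_LI {F U : Type*} [Field F] [Fintype F] [AddCommGroup U] [Module F U] [Finite U]
    (m : ℕ) (hm : m ≤ finrank F U) :
    (Nat.card {w : Fin (m+1) → U // LinearIndependent F w} : ℚ) =
    ∏ i ∈ Finset.range (m+1), ((Fintype.card F : ℚ) ^ (finrank F U) - (Fintype.card F : ℚ) ^ i) := by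
  rcases hm.eq_or_lt with h | h
  · have : IsEmpty {w : Fin (m+1) → U // LinearIndependent F w} := by
      refine ⟨fun w => ?_⟩
      have := w.2.fintype_card_le_finrank
      simp at this
      omega
    rw [Nat.card_of_isEmpty, Nat.cast_zero]
    symm
    apply Finset.prod_eq_zero (i := m) (by simp)
    rw [← h, sub_self]
  · have := Fintype.ofFinite U
    rw [card_linearIndependent (K := F) (V := U) h, Finset.prod_range, Nat.cast_prod]
    refine Finset.prod_congr rfl fun i _ => ?_
    rw [Nat.cast_sub]
    · push_cast; rfl
    · exact Nat.pow_le_pow_right Fintype.card_pos (by omega)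

theorem aux_qb (q a m : ℕ) (hq : 2 ≤ q) (h : m ≤ a) :
    qBinomQ q a (m+1) * (∏ i ∈ Finset.range (m + 1), ((q : ℚ) ^ (m + 1) - (q : ℚ) ^ i)) =
    ∏ i ∈ Finset.range (m+1), ((q : ℚ) ^ a - (q : ℚ) ^ i) := by
  rw [qBinomQ, ← Finset.prod_mul_distrib]
  refine Finset.prod_congr rfl fun i hi => ?_
  have hi : i < m + 1 := by simpa using hi
  have hne : (q : ℚ) ^ (m + 1 - i) - 1 ≠ 0 := by
    have : (1 : ℚ) < (q : ℚ) ^ (m + 1 - i) :=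
      one_lt_pow₀ (by exact_mod_cast (by omega : 1 < q)) (by omega)
    linarith
  have h1 : (q : ℚ) ^ (m+1) = q ^ (m + 1 - i) * q ^ i := by rw [← pow_add]; congr 1; omega
  have h2 : (q : ℚ) ^ a = q ^ (a - i) * q ^ i := by rw [← pow_add]; congr 1; omega
  rw [h1, h2]
  field_simp

/-- Fix `V₀ ∈ 𝕍`.  The number of sets `X ∈ 𝕏` such that `V₀` is not contained in
`Σ_{V_i ∈ X} V_i` equals `[k−t choose m+1]_q · q^{m+1} · ∏_{i=0}^{m}(q^{m+1} − q^i)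
/ ((q−1)^{m+1} (m+1)!)`. -/
theorem stmt4 (q k m t : ℕ) (F : Type*) [Field F] [Fintype F] (hq : Fintype.card F = q)
    (hm : 1 ≤ m) (ht : 1 ≤ t) (hmtk : m + t ≤ k)
    (W : Submodule F (Fin k → F)) (hW : Module.finrank F ↥W = t - 1)
    (V₀ : Submodule F (Fin k → F)) (hV₀ : Module.finrank F ↥V₀ = t ∧ W ≤ V₀) :
    (Nat.card {X : Finset (Submodule F (Fin k → F)) //
        (X.card = m + 1 ∧ (∀ V ∈ X, Module.finrank F ↥V = t ∧ W ≤ V) ∧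
          Module.finrank F ↥(X.sup id) = m + t) ∧
        ¬ V₀ ≤ X.sup id} : ℚ)
      = qBinomQ q (k - t) (m + 1) * (q : ℚ) ^ (m + 1) *
          (∏ i ∈ Finset.range (m + 1), ((q : ℚ) ^ (m + 1) - (q : ℚ) ^ i)) /
          (((q : ℚ) - 1) ^ (m + 1) * (Nat.factorial (m + 1) : ℚ)) := by
  have hF : 2 ≤ q := by
    rw [← hq]; exact Fintype.one_lt_card
  have hA := aux_cardA V₀ (m+1)
  have hAB := aux_AB W V₀ t m ht hW hV₀.1 hV₀.2
  have hBC := aux_BC W V₀ t m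
  have hfr : finrank F ((Fin k → F) ⧸ V₀) = k - t := by
    have := Submodule.finrank_quotient_add_finrank V₀
    rw [hV₀.1, Module.finrank_fin_fun] at this
    omega
  have : Finite ((Fin k → F) ⧸ V₀) := Quotient.finite _
  have hLI := aux_LI (F := F) (U := (Fin k → F) ⧸ V₀) m (by omega)
  rw [hfr, hq, ← aux_qb q (k - t) m hF (by omega)] at hLI
  rw [hAB, hBC, Module.natCard_eq_pow_finrank (K := F) (V := V₀), hV₀.1, Nat.card_eq_fintype_card (α := F),
    hq] at hA
  have hA := congrArg (Nat.cast : ℕ → ℚ) hA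
  rw [Nat.cast_mul, Nat.cast_mul, Nat.cast_mul, hLI, Nat.cast_pow,
    Nat.cast_sub (Nat.pow_le_pow_right (by omega) (by omega))] at hA
  push_cast at hA
  change (Nat.card {X : Finset (Submodule F (Fin k → F)) // PC W V₀ t m X} : ℚ) = _
  generalize (Nat.card {X : Finset (Submodule F (Fin k → F)) // PC W V₀ t m X} : ℚ) = C at *
  obtain ⟨s, rfl⟩ : ∃ s, t = s + 1 := ⟨t - 1, by omega⟩
  have hq0 : (q : ℚ) ≠ 0 := by
    have : q ≠ 0 := by omega
    exact_mod_cast this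
  have hq1 : (q : ℚ) - 1 ≠ 0 := by
    have : (1 : ℚ) < q := by exact_mod_cast (by omega : 1 < q)
    linarith
  have hf : ((m+1).factorial : ℚ) ≠ 0 := by exact_mod_cast Nat.factorial_ne_zero _
  rw [eq_div_iff (mul_ne_zero (pow_ne_zero _ hq1) hf)]
  have e1 : (q : ℚ) ^ (s+1) - (q : ℚ) ^ (s + 1 - 1) = q ^ s * (q - 1) := by
    rw [Nat.add_sub_cancel]; ring
  rw [e1, pow_succ (q : ℚ) s, mul_pow, mul_pow ((q : ℚ) ^ s)] at hA
  have hs : ((q : ℚ) ^ s) ^ (m+1) ≠ 0 := pow_ne_zero _ (pow_ne_zero _ hq0)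
  apply mul_left_cancel₀ hs
  linear_combination hA
end

section
/- Fix X = {V_1, …, V_{m+1}} ∈ 𝕏. Then the number of (m+1)-element sets {A_1, …, A_{m+1}} of 1-dimensional subspaces of F_q^k such that {W + A_1, W + A_2, …, W + A_{m+1}} = X (as sets of subspaces) equals q^{(t−1)(m+1)}. -/
theorem stmt6_lines {F E : Type*} [Field F] [Finite F] [AddCommGroup E] [Module F E]
    [FiniteDimensional F E] (n : ℕ) (W V : Submodule F E)
    (hW : Module.finrank F W = n) (hV : Module.finrank F V = n + 1) (hWV : W ≤ V) :
    Nat.card {a : Submodule F E // Module.finrank F a = 1 ∧ W ⊔ a = V} = Nat.card F ^ n := by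
  have hlt : W < V := lt_of_le_of_ne hWV (by rintro rfl; omega)
  obtain ⟨v, hvV, hvW⟩ := SetLike.exists_of_lt hlt
  have hne : ∀ w ∈ W, v + w ∉ W := fun w hw h => hvW (by simpa using W.sub_mem h hw)
  have hspan : ∀ w ∈ W, W ⊔ Submodule.span F {v + w} = V := by
    intro w hw
    apply Submodule.eq_of_le_of_finrank_le
    · refine sup_le hWV ?_
      rw [Submodule.span_singleton_le_iff_mem]
      exact V.add_mem hvV (hWV hw)
    · have h1 : W < W ⊔ Submodule.span F {v + w} := by
        refine lt_of_le_of_ne le_sup_left fun h => hne w hw ?_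
        rw [h]
        exact Submodule.mem_sup_right (Submodule.mem_span_singleton_self _)
      have := Submodule.finrank_lt_finrank_of_lt h1
      omega
  rw [← hW, ← Module.natCard_eq_pow_finrank (K := F) (V := W)]
  symm
  refine Nat.card_eq_of_bijective (fun w : W => ⟨Submodule.span F {v + (w : E)},
    finrank_span_singleton (fun h => hne w w.2 (h ▸ W.zero_mem)), hspan w w.2⟩) ⟨?_, ?_⟩
  · intro w w' h
    have h1 : Submodule.span F {v + (w : E)} = Submodule.span F {v + (w' : E)} :=
      congrArg Subtype.val h
    have h2 : v + (w' : E) ∈ Submodule.span F {v + (w : E)} :=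
      h1 ▸ Submodule.mem_span_singleton_self _
    obtain ⟨c, hc⟩ := Submodule.mem_span_singleton.1 h2
    have h3 : (c - 1) • v = (w' : E) - c • (w : E) := by
      rw [sub_smul, one_smul, sub_eq_sub_iff_add_eq_add, ← smul_add, hc, add_comm]
    have h4 : (c - 1) • v ∈ W := h3 ▸ W.sub_mem w'.2 (W.smul_mem c w.2)
    have h5 : c - 1 = 0 := by
      by_contra h0
      exact hvW ((W.smul_mem_iff h0).1 h4)
    have h6 : c = 1 := sub_eq_zero.1 h5
    subst h6
    rw [one_smul] at hc
    exact Subtype.ext (add_left_cancel hc)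
  · rintro ⟨a, ha, haV⟩
    have hv' : v ∈ W ⊔ a := haV ▸ hvV
    obtain ⟨w, hw, x, hx, hwx⟩ := Submodule.mem_sup.1 hv'
    refine ⟨⟨-w, W.neg_mem hw⟩, Subtype.ext ?_⟩
    have hxe : v + -w = x := by rw [← hwx]; abel
    change Submodule.span F {v + -w} = a
    have hx0 : v + -w ≠ 0 := fun h => hne (-w) (W.neg_mem hw) (h ▸ W.zero_mem)
    apply Submodule.eq_of_le_of_finrank_le
    · rw [Submodule.span_singleton_le_iff_mem, hxe]
      exact hx
    · rw [ha, finrank_span_singleton hx0]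

/-- Fix `X = {V_1, …, V_{m+1}} ∈ 𝕏`.  The number of `(m+1)`-element sets
`{A_1, …, A_{m+1}}` of `1`-dimensional subspaces of `F_q^k` such that
`{W + A_1, …, W + A_{m+1}} = X` equals `q^{(t−1)(m+1)}`. -/
theorem stmt6 (q k m t : ℕ) (F : Type*) [Field F] [Fintype F]
    [DecidableEq (Submodule F (Fin k → F))]
    (hq : Fintype.card F = q)
    (hm : 1 ≤ m) (ht : 1 ≤ t) (hmtk : m + t ≤ k)
    (W : Submodule F (Fin k → F)) (hW : Module.finrank F ↥W = t - 1)
    (X : Finset (Submodule F (Fin k → F)))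
    (hXcard : X.card = m + 1)
    (hXmem : ∀ V ∈ X, Module.finrank F ↥V = t ∧ W ≤ V)
    (hXdim : Module.finrank F ↥(X.sup id) = m + t) :
    Nat.card {A : Finset (Submodule F (Fin k → F)) //
        A.card = m + 1 ∧ (∀ a ∈ A, Module.finrank F ↥a = 1) ∧
        A.image (fun a => W ⊔ a) = X}
      = q ^ ((t - 1) * (m + 1)) := by
  have hl : ∀ V : X, Nat.card {a : Submodule F (Fin k → F) //
      Module.finrank F a = 1 ∧ W ⊔ a = V} = q ^ (t - 1) := by
    intro V
    rw [stmt6_lines (t - 1) W V hW (by rw [(hXmem V V.2).1]; omega) (hXmem V V.2).2,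
      Nat.card_eq_fintype_card, hq]
  have hpi : Nat.card (∀ V : X, {a : Submodule F (Fin k → F) //
      Module.finrank F a = 1 ∧ W ⊔ a = V}) = q ^ ((t - 1) * (m + 1)) := by
    rw [Nat.card_pi, Finset.prod_congr rfl (fun V _ => hl V), Finset.prod_const,
      Finset.card_univ, Fintype.card_coe, hXcard, pow_mul]
  rw [← hpi]
  symm
  have hinj : ∀ s : (∀ V : X, {a : Submodule F (Fin k → F) //
      Module.finrank F a = 1 ∧ W ⊔ a = V}), Function.Injective (fun V => (s V).1) := by
    intro s V V' h
    have h' : (s V).1 = (s V').1 := h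
    apply Subtype.ext
    rw [← (s V).2.2, ← (s V').2.2, h']
  have hcard : ∀ s : (∀ V : X, {a : Submodule F (Fin k → F) //
      Module.finrank F a = 1 ∧ W ⊔ a = V}),
      (Finset.univ.image (fun V => (s V).1)).card = m + 1 := by
    intro s
    rw [Finset.card_image_of_injective _ (hinj s), Finset.card_univ, Fintype.card_coe, hXcard]
  refine Nat.card_eq_of_bijective (fun s => ⟨Finset.univ.image (fun V => (s V).1),
    hcard s, ?_, ?_⟩) ⟨?_, ?_⟩
  · intro a ha
    obtain ⟨V, -, rfl⟩ := Finset.mem_image.1 ha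
    exact (s V).2.1
  · ext U
    simp only [Finset.mem_image, Finset.mem_univ, true_and]
    constructor
    · rintro ⟨a, ⟨V, rfl⟩, rfl⟩
      rw [(s V).2.2]
      exact V.2
    · intro hU
      exact ⟨_, ⟨⟨U, hU⟩, rfl⟩, (s ⟨U, hU⟩).2.2⟩
  · intro s s' h
    have h1 : Finset.univ.image (fun V => (s V).1) = Finset.univ.image (fun V => (s' V).1) :=
      congrArg Subtype.val h
    funext V
    have h2 : (s V).1 ∈ Finset.univ.image (fun V => (s' V).1) :=
      h1 ▸ Finset.mem_image_of_mem _ (Finset.mem_univ V)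
    obtain ⟨V', -, h3⟩ := Finset.mem_image.1 h2
    have h4 : V' = V := by
      apply Subtype.ext
      rw [← (s V).2.2, ← (s' V').2.2, h3]
    subst h4
    exact Subtype.ext h3.symm
  · rintro ⟨A, hA, hA1, hAX⟩
    have hex : ∀ V : X, ∃ a ∈ A, W ⊔ a = V := by
      rintro ⟨V, hV⟩
      rw [← hAX] at hV
      exact Finset.mem_image.1 hV
    choose f hfA hfV using hex
    refine ⟨fun V => ⟨f V, hA1 _ (hfA V), hfV V⟩, Subtype.ext ?_⟩
    apply Finset.eq_of_subset_of_card_le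
    · intro a ha
      obtain ⟨V, -, rfl⟩ := Finset.mem_image.1 ha
      exact hfA V
    · rw [hcard, hA]
end

section
/- Fix a subspace P of F_q^k of dimension m+t with W ⊆ P. Then the number of sets X ∈ 𝕏 with Σ_{V_i ∈ X} V_i = P equals ∏_{i=0}^{m}(q^{m+1} − q^{i}) / ((q−1)^{m+1} (m+1)!). -/
open Module in
lemma aux_L {F U : Type*} [Field F] [Fintype F] [AddCommGroup U] [Module F U] [Finite U]
    (Q : Submodule F U) (n : ℕ) (hQ : finrank F Q = n) :
    Nat.card {s : Fin n → U // Submodule.span F (Set.range s) = Q}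
      = ∏ i : Fin n, (Fintype.card F ^ n - Fintype.card F ^ i.val) := by
  have := Fintype.ofFinite Q
  have h := card_linearIndependent (K := F) (V := Q) (k := n) hQ.ge
  rw [hQ] at h
  rw [← h]
  symm
  refine Nat.card_congr (Equiv.ofBijective (fun s => ⟨fun i => (s.1 i : U), ?_⟩) ⟨?_, ?_⟩)
  · have h1 := s.2.span_eq_top_of_card_eq_finrank' (by simp [hQ])
    have h2 : Set.range (fun i => (s.1 i : U)) = Q.subtype '' Set.range s.1 := by
      rw [← Set.range_comp]; rfl
    rw [h2, ← Submodule.map_span, h1]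
    simp
  · intro s s' hs
    ext i
    exact congrFun (congrArg Subtype.val hs) i
  · rintro ⟨s, hs⟩
    have hm : ∀ i, s i ∈ Q := fun i => hs ▸ Submodule.subset_span ⟨i, rfl⟩
    refine ⟨⟨fun i => ⟨s i, hm i⟩, ?_⟩, rfl⟩
    have : LinearIndependent F s := by
      rw [linearIndependent_iff_card_eq_finrank_span]
      rw [Set.finrank, hs, hQ]; simp
    exact LinearIndependent.of_comp Q.subtype this

open Module in
lemma aux_A {F U : Type*} [Field F] [Fintype F] [AddCommGroup U] [Module F U] [Finite U]
    (Q : Submodule F U) (n : ℕ) (hQ : finrank F Q = n) :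
    Nat.card {s : Fin n → U // Submodule.span F (Set.range s) = Q}
      = Nat.card {V : Fin n → Submodule F U // (∀ i, finrank F (V i) = 1) ∧ ⨆ i, V i = Q}
        * (Fintype.card F - 1) ^ n := by
  classical
  have hg : ∀ V : Submodule F U, ∃ g : U, finrank F V = 1 → g ≠ 0 ∧ Submodule.span F {g} = V := by
    intro V
    by_cases h : finrank F V = 1
    · obtain ⟨v, hv, h2⟩ := finrank_eq_one_iff'.1 h
      refine ⟨v, fun _ => ⟨by simpa using hv, ?_⟩⟩
      apply le_antisymm
      · simp
      · intro w hw
        obtain ⟨c, hc⟩ := h2 ⟨w, hw⟩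
        exact Submodule.mem_span_singleton.2 ⟨c, congrArg Subtype.val hc⟩
    · exact ⟨0, fun h' => absurd h' h⟩
  choose g hg using hg
  have hc : (Fintype.card F - 1) ^ n = Nat.card (Fin n → Fˣ) := by
    simp [Nat.card_eq_fintype_card, Fintype.card_units]
  rw [hc, ← Nat.card_prod]
  symm
  have hsp : ∀ (V : Submodule F U) (u : Fˣ), finrank F V = 1 →
      Submodule.span F {(u : F) • g V} = V := by
    intro V u hV
    rw [Submodule.span_singleton_smul_eq u.isUnit]
    exact (hg V hV).2
  refine Nat.card_congr (Equiv.ofBijective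
    (fun p => ⟨fun i => (p.2 i : F) • g (p.1.1 i), ?_⟩) ⟨?_, ?_⟩)
  · rw [Submodule.span_range_eq_iSup]
    exact (iSup_congr fun i => hsp _ _ (p.1.2.1 i)).trans p.1.2.2
  · rintro ⟨⟨V, hV⟩, u⟩ ⟨⟨V', hV'⟩, u'⟩ h
    have h' : ∀ i, (u i : F) • g (V i) = (u' i : F) • g (V' i) :=
      fun i => congrFun (congrArg Subtype.val h) i
    have hVV : V = V' := by
      ext1 i
      rw [← hsp (V i) (u i) (hV.1 i), h' i, hsp _ _ (hV'.1 i)]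
    subst hVV
    have : u = u' := by
      ext i
      exact smul_left_injective F (hg _ (hV.1 i)).1 (h' i)
    rw [this]
  · rintro ⟨s, hs⟩
    have hli : LinearIndependent F s := by
      rw [linearIndependent_iff_card_eq_finrank_span]
      rw [Set.finrank, hs, hQ]; simp
    have h1 : ∀ i, finrank F (Submodule.span F {s i}) = 1 :=
      fun i => finrank_span_singleton (hli.ne_zero i)
    have h2 : ∀ i, ∃ u : Fˣ, (u : F) • g (Submodule.span F {s i}) = s i := by
      intro i
      have h3 : s i ∈ Submodule.span F {g (Submodule.span F {s i})} := by
        rw [(hg _ (h1 i)).2]; exact Submodule.mem_span_singleton_self _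
      obtain ⟨c, hc⟩ := Submodule.mem_span_singleton.1 h3
      have : c ≠ 0 := by
        rintro rfl
        exact hli.ne_zero i (by rw [← hc, zero_smul])
      exact ⟨Units.mk0 c this, hc⟩
    choose u hu using h2
    refine ⟨⟨⟨fun i => Submodule.span F {s i}, h1, ?_⟩, u⟩, ?_⟩
    · rw [← hs, Submodule.span_range_eq_iSup]
    · exact Subtype.ext (funext hu)

open Module in
lemma aux_B {F U : Type*} [Field F] [Fintype F] [AddCommGroup U] [Module F U] [Finite U]
    (Q : Submodule F U) (n : ℕ) (hQ : finrank F Q = n) :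
    Nat.card {V : Fin n → Submodule F U // (∀ i, finrank F (V i) = 1) ∧ ⨆ i, V i = Q}
      = Nat.card {X : Finset (Submodule F U) // X.card = n ∧ (∀ V ∈ X, finrank F V = 1) ∧
          X.sup id = Q} * n.factorial := by
  classical
  have hc : n.factorial = Nat.card (Equiv.Perm (Fin n)) := by
    simp [Nat.card_eq_fintype_card, Fintype.card_perm]
  rw [hc, ← Nat.card_prod]
  symm
  have e : ∀ X : {X : Finset (Submodule F U) // X.card = n ∧ (∀ V ∈ X, finrank F V = 1) ∧
          X.sup id = Q}, Fin n ≃ X.1 := fun X => (X.1.equivFinOfCardEq X.2.1).symm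
  have him : ∀ X (σ : Equiv.Perm (Fin n)),
      Finset.univ.image (fun i => ((e X) (σ i)).1) = X.1 := by
    intro X σ
    ext V
    simp only [Finset.mem_image, Finset.mem_univ, true_and]
    constructor
    · rintro ⟨i, rfl⟩
      exact (e X (σ i)).2
    · intro hV
      exact ⟨σ.symm ((e X).symm ⟨V, hV⟩), by simp⟩
  refine Nat.card_congr (Equiv.ofBijective
    (fun p => ⟨fun i => (e p.1 (p.2 i)).1, fun i => p.1.2.2.1 _ (e p.1 (p.2 i)).2, ?_⟩) ⟨?_, ?_⟩)
  · have h := p.1.2.2.2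
    rw [← him p.1 p.2, Finset.sup_image, Finset.sup_univ_eq_iSup] at h
    exact h
  · rintro ⟨X, σ⟩ ⟨X', σ'⟩ h
    have h' : (fun i => ((e X) (σ i)).1) = (fun i => ((e X') (σ' i)).1) :=
      congrArg Subtype.val h
    have hX : X = X' := by
      apply Subtype.ext
      rw [← him X σ, h', him]
    subst hX
    have : σ = σ' := by
      ext1 i
      exact (e X).injective (Subtype.ext (congrFun h' i))
    rw [this]
  · rintro ⟨V, hV, hs⟩
    have hcard : (Finset.univ.image V).card = n := by
      apply le_antisymm (Finset.card_image_le.trans (by simp))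
      have : ∀ Y : Finset (Submodule F U), (∀ V ∈ Y, finrank F V = 1) →
          finrank F (Y.sup id : Submodule F U) ≤ Y.card := by
        intro Y
        induction Y using Finset.induction_on with
        | empty => simp
        | insert a Y ha ih =>
          intro h
          rw [Finset.sup_insert, Finset.card_insert_of_notMem ha]
          have h1 := ih fun V hV => h V (Finset.mem_insert_of_mem hV)
          have h2 := h a (Finset.mem_insert_self _ _)
          have h3 := Submodule.finrank_add_le_finrank_add_finrank a (Y.sup id)
          simp only [id] at *
          omega
      have h := this (Finset.univ.image V) (by simpa using hV)
      rw [Finset.sup_image, Finset.sup_univ_eq_iSup] at h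
      have hs2 : iSup V = Q := hs
      rw [Function.id_comp, hs2, hQ] at h
      exact h
    have hinj : Function.Injective V := by
      rw [← Set.injOn_univ, ← Finset.coe_univ, ← Finset.card_image_iff, hcard]
      simp
    let X : {X : Finset (Submodule F U) // X.card = n ∧ (∀ V ∈ X, finrank F V = 1) ∧
          X.sup id = Q} := ⟨Finset.univ.image V, hcard, by simpa using hV, by
            rw [Finset.sup_image, Finset.sup_univ_eq_iSup]; exact hs⟩
    let f : Fin n → Fin n := fun i => (e X).symm ⟨V i, Finset.mem_image_of_mem V (Finset.mem_univ i)⟩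
    have hf : Function.Injective f := by
      intro i j hij
      have := (e X).symm.injective hij
      exact hinj (congrArg Subtype.val this)
    refine ⟨⟨X, Equiv.ofBijective f (Finite.injective_iff_bijective.1 hf)⟩, ?_⟩
    apply Subtype.ext
    funext i
    simp [f]

open Module in
lemma aux_C {F E : Type*} [Field F] [Fintype F] [AddCommGroup E] [Module F E] [Finite E]
    (W P : Submodule F E) (hWP : W ≤ P) (n t : ℕ) (hn : 1 ≤ n) (hW : finrank F W + 1 = t) :
    Nat.card {X : Finset (Submodule F E) // X.card = n ∧
      (∀ V ∈ X, finrank F V = t ∧ W ≤ V) ∧ X.sup id = P} =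
    Nat.card {X : Finset (Submodule F (E ⧸ W)) // X.card = n ∧ (∀ V ∈ X, finrank F V = 1) ∧
          X.sup id = P.map W.mkQ} := by
  classical
  have hr : ∀ V : Submodule F E, W ≤ V → finrank F (V.map W.mkQ) + finrank F W = finrank F V := by
    intro V hV
    have h := LinearMap.finrank_range_add_finrank_ker (W.mkQ.domRestrict V)
    rw [LinearMap.range_domRestrict, LinearMap.ker_domRestrict, Submodule.ker_mkQ] at h
    rw [← h, (Submodule.comapSubtypeEquivOfLe hV).finrank_eq]
  have hcm : ∀ V : Submodule F E, W ≤ V → (V.map W.mkQ).comap W.mkQ = V := by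
    intro V hV
    rw [Submodule.comap_map_mkQ, sup_eq_right.2 hV]
  have hmc : ∀ V : Submodule F (E ⧸ W), (V.comap W.mkQ).map W.mkQ = V := fun V =>
    Submodule.map_comap_eq_of_surjective W.mkQ_surjective V
  have hWc : ∀ V : Submodule F (E ⧸ W), W ≤ V.comap W.mkQ := fun V => Submodule.le_comap_mkQ W V
  have hsup : ∀ X : Finset (Submodule F E),
      (X.image (Submodule.map W.mkQ)).sup id = (X.sup id).map W.mkQ := by
    intro X
    induction X using Finset.induction_on with
    | empty => simp
    | insert a Y ha ih => rw [Finset.image_insert, Finset.sup_insert, Finset.sup_insert, ih,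
        Submodule.map_sup]; rfl
  have hii : ∀ Y : Finset (Submodule F (E ⧸ W)),
      (Y.image (Submodule.comap W.mkQ)).image (Submodule.map W.mkQ) = Y := by
    intro Y
    rw [Finset.image_image]
    have : Submodule.map W.mkQ ∘ Submodule.comap W.mkQ = id := funext hmc
    rw [this, Finset.image_id]
  refine Nat.card_congr ⟨fun X => ⟨X.1.image (Submodule.map W.mkQ), ?_, ?_, ?_⟩,
    fun Y => ⟨Y.1.image (Submodule.comap W.mkQ), ?_, ?_, ?_⟩, ?_, ?_⟩
  · rw [Finset.card_image_of_injOn, X.2.1]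
    intro V hV V' hV' h
    rw [← hcm V (X.2.2.1 V hV).2, ← hcm V' (X.2.2.1 V' hV').2]
    exact congrArg _ h
  · simp only [Finset.mem_image]
    rintro _ ⟨V, hV, rfl⟩
    have h1 := X.2.2.1 V hV
    have := hr V h1.2
    omega
  · rw [hsup, X.2.2.2]
  · rw [Finset.card_image_of_injective, Y.2.1]
    exact Function.LeftInverse.injective hmc
  · simp only [Finset.mem_image]
    rintro _ ⟨V, hV, rfl⟩
    have h1 := Y.2.2.1 V hV
    have := hr _ (hWc V)
    rw [hmc] at this
    exact ⟨by omega, hWc V⟩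
  · have h1 : ((Y.1.image (Submodule.comap W.mkQ)).sup id).map W.mkQ = P.map W.mkQ := by
      rw [← hsup, hii, Y.2.2.2]
    obtain ⟨V, hV⟩ : Y.1.Nonempty := Finset.card_pos.1 (by rw [Y.2.1]; omega)
    have h2 : W ≤ (Y.1.image (Submodule.comap W.mkQ)).sup id :=
      (hWc V).trans (Finset.le_sup (f := id) (Finset.mem_image_of_mem _ hV))
    rw [← hcm _ h2, h1, hcm _ hWP]
  · intro X
    apply Subtype.ext
    change (X.1.image (Submodule.map W.mkQ)).image (Submodule.comap W.mkQ) = X.1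
    rw [Finset.image_image]
    conv_rhs => rw [← Finset.image_id (s := X.1)]
    exact Finset.image_congr fun V hV => hcm V (X.2.2.1 V hV).2
  · intro Y
    exact Subtype.ext (hii Y.1)

/-- Fix a subspace `P` of `F_q^k` of dimension `m+t` with `W ⊆ P`.  The number of sets
`X ∈ 𝕏` with `Σ_{V_i ∈ X} V_i = P` equals
`∏_{i=0}^{m}(q^{m+1} − q^i) / ((q−1)^{m+1} (m+1)!)`. -/
theorem stmt8 (q k m t : ℕ) (F : Type*) [Field F] [Fintype F] (hq : Fintype.card F = q)
    (hm : 1 ≤ m) (ht : 1 ≤ t) (hmtk : m + t ≤ k)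
    (W : Submodule F (Fin k → F)) (hW : Module.finrank F ↥W = t - 1)
    (P : Submodule F (Fin k → F)) (hP : Module.finrank F ↥P = m + t) (hWP : W ≤ P) :
    (Nat.card {X : Finset (Submodule F (Fin k → F)) //
        (X.card = m + 1 ∧ (∀ V ∈ X, Module.finrank F ↥V = t ∧ W ≤ V) ∧
          Module.finrank F ↥(X.sup id) = m + t) ∧
        X.sup id = P} : ℚ)
      = (∏ i ∈ Finset.range (m + 1), ((q : ℚ) ^ (m + 1) - (q : ℚ) ^ i)) /
          (((q : ℚ) - 1) ^ (m + 1) * (Nat.factorial (m + 1) : ℚ)) := by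
  classical
  have hW' : Module.finrank F W + 1 = t := by omega
  have hQ : Module.finrank F (P.map W.mkQ) = m + 1 := by
    have h := LinearMap.finrank_range_add_finrank_ker (W.mkQ.domRestrict P)
    rw [LinearMap.range_domRestrict, LinearMap.ker_domRestrict, Submodule.ker_mkQ,
      (Submodule.comapSubtypeEquivOfLe hWP).finrank_eq] at h
    omega
  have hS : Nat.card {X : Finset (Submodule F (Fin k → F)) //
        (X.card = m + 1 ∧ (∀ V ∈ X, Module.finrank F ↥V = t ∧ W ≤ V) ∧
          Module.finrank F ↥(X.sup id) = m + t) ∧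
        X.sup id = P} = Nat.card {X : Finset (Submodule F (Fin k → F)) // X.card = m + 1 ∧
      (∀ V ∈ X, Module.finrank F V = t ∧ W ≤ V) ∧ X.sup id = P} := by
    refine Nat.card_congr (Equiv.subtypeEquivRight fun X => ?_)
    constructor
    · rintro ⟨⟨h1, h2, h3⟩, h4⟩
      exact ⟨h1, h2, h4⟩
    · rintro ⟨h1, h2, h4⟩
      exact ⟨⟨h1, h2, by rw [h4, hP]⟩, h4⟩
  have : Finite ((Fin k → F) ⧸ W) := Finite.of_surjective _ W.mkQ_surjective
  have h1 := aux_L (P.map W.mkQ) (m + 1) hQ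
  rw [aux_A _ _ hQ, aux_B _ _ hQ, ← aux_C W P hWP (m + 1) t (by omega) hW', ← hS, hq] at h1
  have hq1 : 1 < q := hq ▸ Fintype.one_lt_card
  have h2 := congrArg (Nat.cast : ℕ → ℚ) h1
  have h3 : ((∏ i : Fin (m + 1), (q ^ (m + 1) - q ^ i.val) : ℕ) : ℚ)
      = ∏ i ∈ Finset.range (m + 1), ((q : ℚ) ^ (m + 1) - (q : ℚ) ^ i) := by
    rw [← Fin.prod_univ_eq_prod_range (fun i => (q : ℚ) ^ (m + 1) - (q : ℚ) ^ i), Nat.cast_prod]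
    refine Finset.prod_congr rfl fun i _ => ?_
    rw [Nat.cast_sub (Nat.pow_le_pow_right hq1.le i.2.le)]
    push_cast; rfl
  rw [h3] at h2
  have hq2 : (q : ℚ) - 1 ≠ 0 := by
    have : (1 : ℚ) < q := by exact_mod_cast hq1
    linarith
  rw [eq_div_iff (mul_ne_zero (pow_ne_zero _ hq2) (by exact_mod_cast (Nat.factorial_ne_zero _))),
    ← h2, Nat.cast_mul, Nat.cast_mul, Nat.cast_pow, Nat.cast_sub hq1.le, Nat.cast_one]
  ring
end

section
/- Suppose m + t + 1 ≤ k and let Y = {V_1, …, V_{m+2}} be a set of m+2 distinct t-dimensional subspaces of F_q^k, each containing W, such that dim(V_1 + ⋯ + V_{m+2}) = m + t + 1. Then for every index i ∈ {1, …, m+2}: dim(Σ_{l ≠ i} V_l) = m + t and V_i ⊄ Σ_{l ≠ i} V_l; in particular Y \ {V_i} ∈ 𝕏. -/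
theorem aux_step {F M : Type*} [Field F] [AddCommGroup M] [Module F M] [FiniteDimensional F M]
    (t : ℕ) (ht : 1 ≤ t) (W V A : Submodule F M) (hW : Module.finrank F ↥W = t - 1)
    (hV : Module.finrank F ↥V = t) (hWV : W ≤ V) (hWA : W ≤ A) :
    Module.finrank F ↥(V ⊔ A) ≤ Module.finrank F ↥A + 1 := by
  have h1 := Submodule.finrank_sup_add_finrank_inf_eq V A
  have h2 := Submodule.finrank_mono (le_inf hWV hWA)
  omega

theorem aux_bound {F M : Type*} [Field F] [AddCommGroup M] [Module F M] [FiniteDimensional F M]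
    (t : ℕ) (ht : 1 ≤ t) (W : Submodule F M) (hW : Module.finrank F ↥W = t - 1)
    (S : Finset (Submodule F M)) (hS : ∀ V ∈ S, Module.finrank F ↥V = t ∧ W ≤ V) :
    Module.finrank F ↥(W ⊔ S.sup id) ≤ t - 1 + S.card := by
  classical
  induction S using Finset.induction_on with
  | empty => rw [Finset.sup_empty, sup_bot_eq, hW]; omega
  | insert V S hVS ih =>
    have ih' := ih (fun V' h => hS V' (Finset.mem_insert_of_mem h))
    obtain ⟨hV, hWV⟩ := hS V (Finset.mem_insert_self _ _)
    have h := aux_step t ht W V (W ⊔ S.sup id) hW hV hWV le_sup_left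
    rw [Finset.sup_insert, id, sup_left_comm, Finset.card_insert_of_notMem hVS]
    omega

/-- Suppose `m + t + 1 ≤ k` and let `Y = {V_1, …, V_{m+2}}` be a set of `m+2` distinct
`t`-dimensional subspaces of `F_q^k`, each containing `W`, with
`dim (V_1 + ⋯ + V_{m+2}) = m + t + 1`.  Then for every `V_i ∈ Y`:
`dim (Σ_{l ≠ i} V_l) = m + t` and `V_i ⊄ Σ_{l ≠ i} V_l`; in particular
`Y \ {V_i} ∈ 𝕏`. -/
theorem stmt10 (q k m t : ℕ) (F : Type*) [Field F] [Fintype F]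
    [DecidableEq (Submodule F (Fin k → F))]
    (hq : Fintype.card F = q)
    (hm : 1 ≤ m) (ht : 1 ≤ t) (hk : m + t + 1 ≤ k)
    (W : Submodule F (Fin k → F)) (hW : Module.finrank F ↥W = t - 1)
    (Y : Finset (Submodule F (Fin k → F)))
    (hYcard : Y.card = m + 2)
    (hYmem : ∀ V ∈ Y, Module.finrank F ↥V = t ∧ W ≤ V)
    (hYdim : Module.finrank F ↥(Y.sup id) = m + t + 1) :
    ∀ V ∈ Y,
      Module.finrank F ↥((Y.erase V).sup id) = m + t ∧
      ¬ V ≤ (Y.erase V).sup id ∧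
      ((Y.erase V).card = m + 1 ∧
        (∀ V' ∈ Y.erase V, Module.finrank F ↥V' = t ∧ W ≤ V') ∧
        Module.finrank F ↥((Y.erase V).sup id) = m + t) := by
  intro V hVY
  obtain ⟨hV, hWV⟩ := hYmem V hVY
  have hc : (Y.erase V).card = m + 1 := by rw [Finset.card_erase_of_mem hVY]; omega
  have hmem : ∀ V' ∈ Y.erase V, Module.finrank F ↥V' = t ∧ W ≤ V' :=
    fun V' h => hYmem V' (Finset.mem_of_mem_erase h)
  have hsup : Y.sup id = V ⊔ (Y.erase V).sup id := by
    conv_lhs => rw [← Finset.insert_erase hVY]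
    rw [Finset.sup_insert, id]
  have hWE : W ≤ (Y.erase V).sup id := by
    obtain ⟨V', h'⟩ : (Y.erase V).Nonempty := Finset.card_pos.mp (by omega)
    exact (hmem V' h').2.trans (Finset.le_sup (f := id) h')
  have hb := aux_bound t ht W hW _ hmem
  rw [sup_eq_right.mpr hWE] at hb
  have hs := aux_step t ht W V _ hW hV hWV hWE
  rw [hsup] at hYdim
  have hE : Module.finrank F ↥((Y.erase V).sup id) = m + t := by omega
  refine ⟨hE, fun hle => ?_, hc, hmem, hE⟩
  rw [sup_eq_right.mpr hle] at hYdim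
  omega
end

section
/- Suppose m + t + 1 ≤ k. Then every vertex (V, X) of the caching line graph L lies in exactly one of the cliques C_Y with Y ∈ 𝕐; namely, the sets C_Y for Y ∈ 𝕐 are pairwise disjoint and their union equals the whole vertex set of L, with the vertex (V, X) lying in C_{X ∪ {V}}. -/
/-- The vertices of the caching line graph: pairs `(V, X)` with `V ∈ 𝕍`, `X ∈ 𝕏` and
`V ⊄ Σ_{V_i ∈ X} V_i`. -/
def CacheVtx (F : Type*) [Field F] (k m t : ℕ) (W : Submodule F (Fin k → F)) : Type _ :=
  {p : Submodule F (Fin k → F) × Finset (Submodule F (Fin k → F)) //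
    (Module.finrank F ↥p.1 = t ∧ W ≤ p.1) ∧
    (p.2.card = m + 1 ∧ (∀ V ∈ p.2, Module.finrank F ↥V = t ∧ W ≤ V) ∧
      Module.finrank F ↥(p.2.sup id) = m + t) ∧
    ¬ p.1 ≤ p.2.sup id}

/-- The family `𝕐`: `(m+2)`-element sets of `t`-dimensional subspaces containing `W`
whose sum has dimension `m + t + 1`. -/
def setY (F : Type*) [Field F] (k m t : ℕ) (W : Submodule F (Fin k → F)) :
    Set (Finset (Submodule F (Fin k → F))) :=
  {Y | Y.card = m + 2 ∧ (∀ V ∈ Y, Module.finrank F ↥V = t ∧ W ≤ V) ∧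
    Module.finrank F ↥(Y.sup id) = m + t + 1}

/-- For `Y ∈ 𝕐`, the set of vertices `C_Y = {(V, Y \ {V}) : V ∈ Y}`. -/
def cliqueCY (F : Type*) [Field F] (k m t : ℕ) [DecidableEq (Submodule F (Fin k → F))]
    (W : Submodule F (Fin k → F)) (Y : Finset (Submodule F (Fin k → F))) :
    Set (CacheVtx F k m t W) :=
  {c | ∃ V ∈ Y, c.val = (V, Y.erase V)}

/-- Every vertex `(V, X)` of the caching line graph lies in exactly one of the cliques
`C_Y`, `Y ∈ 𝕐`: the sets `C_Y` are pairwise disjoint, their union is the whole vertex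
set, and the vertex `(V, X)` lies in `C_{X ∪ {V}}`. -/
theorem stmt12 (q k m t : ℕ) (F : Type*) [Field F] [Fintype F]
    [DecidableEq (Submodule F (Fin k → F))]
    (hq : Fintype.card F = q)
    (hm : 1 ≤ m) (ht : 1 ≤ t) (hk : m + t + 1 ≤ k)
    (W : Submodule F (Fin k → F)) (hW : Module.finrank F ↥W = t - 1) :
    (∀ Y ∈ setY F k m t W, ∀ Y' ∈ setY F k m t W, Y ≠ Y' →
        Disjoint (cliqueCY F k m t W Y) (cliqueCY F k m t W Y')) ∧
      (⋃ Y ∈ setY F k m t W, cliqueCY F k m t W Y) = (Set.univ : Set (CacheVtx F k m t W)) ∧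
      (∀ v : CacheVtx F k m t W,
        insert v.val.1 v.val.2 ∈ setY F k m t W ∧
        v ∈ cliqueCY F k m t W (insert v.val.1 v.val.2)) := by
  have key : ∀ v : CacheVtx F k m t W,
        insert v.val.1 v.val.2 ∈ setY F k m t W ∧
        v ∈ cliqueCY F k m t W (insert v.val.1 v.val.2) := by
    rintro ⟨⟨V, X⟩, ⟨hV, hWV⟩, ⟨hc, hX, hr⟩, hn⟩
    dsimp only at hV hWV hc hX hr hn ⊢
    have hVX : V ∉ X := fun h => hn (Finset.le_sup (f := id) h)
    have hWS : W ≤ X.sup id := by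
      obtain ⟨U, hU⟩ : X.Nonempty := Finset.card_pos.mp (by omega)
      exact (hX U hU).2.trans (Finset.le_sup (f := id) hU)
    have h1 : Module.finrank F W ≤ Module.finrank F ↥(V ⊓ X.sup id) :=
      Submodule.finrank_mono (le_inf hWV hWS)
    have h2 : Module.finrank F ↥(V ⊓ X.sup id) < Module.finrank F V :=
      Submodule.finrank_lt_finrank_of_lt (inf_lt_left.mpr hn)
    have h3 := Submodule.finrank_sup_add_finrank_inf_eq V (X.sup id)
    refine ⟨⟨?_, ?_, ?_⟩, V, Finset.mem_insert_self _ _, ?_⟩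
    · rw [Finset.card_insert_of_notMem hVX]; omega
    · intro U hU
      rcases Finset.mem_insert.mp hU with rfl | h
      · exact ⟨hV, hWV⟩
      · exact hX U h
    · rw [Finset.sup_insert, id]; omega
    · rw [Finset.erase_insert hVX]
  refine ⟨?_, ?_, key⟩
  · intro Y _ Y' _ hne
    rw [Set.disjoint_left]
    rintro c ⟨V, hV, h⟩ ⟨V', hV', h'⟩
    rw [h, Prod.mk.injEq] at h'
    obtain ⟨rfl, h'⟩ := h'
    exact hne (by rw [← Finset.insert_erase hV, h', Finset.insert_erase hV'])
  · refine Set.eq_univ_of_forall fun v => ?_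
    exact Set.mem_biUnion (key v).1 (key v).2
end

section
/- Let K = (q^{k−t+1} − 1)/(q − 1). Then the number of (m+1)-element sets {V_1, …, V_{m+1}} of t-dimensional subspaces of F_q^k, each containing W, with dim(V_1 + ⋯ + V_{m+1}) = m + t, satisfies the upper bound |𝕏| ≤ K · q^{(k−m−t)m + (m+1)²} / (m+1)!. -/
open Classical in
theorem aux_filter_card (F : Type*) [Field F] [Fintype F] (k : ℕ) (V : Submodule F (Fin k → F)) :
    (Finset.univ.filter (fun x => x ∈ V)).card = Fintype.card F ^ Module.finrank F V := by
  rw [← Module.card_eq_pow_finrank (K := F) (V := V), Fintype.card_subtype]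

open Classical in
theorem aux_count (F : Type*) [Field F] [Fintype F] (k t : ℕ) (ht : 1 ≤ t)
    (W : Submodule F (Fin k → F)) (hW : Module.finrank F ↥W = t - 1)
    (S : Finset (Submodule F (Fin k → F)))
    (hS : ∀ V ∈ S, Module.finrank F ↥V = t ∧ W ≤ V) :
    S.card * (Fintype.card F ^ t - Fintype.card F ^ (t - 1)) ≤
      Fintype.card F ^ k - Fintype.card F ^ (t - 1) := by
  let f : Submodule F (Fin k → F) → Finset (Fin k → F) := fun V =>
    (Finset.univ.filter (fun x => x ∈ V)) \ (Finset.univ.filter (fun x => x ∈ W))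
  have hdisj : (S : Set (Submodule F (Fin k → F))).PairwiseDisjoint f := by
    intro V hV V' hV' hne
    rw [Function.onFun, Finset.disjoint_left]
    intro x hx hx'
    simp only [f, Finset.mem_sdiff, Finset.mem_filter, Finset.mem_univ, true_and] at hx hx'
    apply hne
    obtain ⟨h1, h2⟩ := hS V hV
    obtain ⟨h1', h2'⟩ := hS V' hV'
    have hlt : W < V ⊓ V' :=
      lt_of_le_of_ne (le_inf h2 h2') (fun h => hx.2 (h ▸ ⟨hx.1, hx'.1⟩))
    have hf := Submodule.finrank_lt_finrank_of_lt hlt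
    have e1 : V ⊓ V' = V := Submodule.eq_of_le_of_finrank_le inf_le_left (by omega)
    have e2 : V ⊓ V' = V' := Submodule.eq_of_le_of_finrank_le inf_le_right (by omega)
    exact e1.symm.trans e2
  have hcard : ∀ V ∈ S, (f V).card = Fintype.card F ^ t - Fintype.card F ^ (t - 1) := by
    intro V hV
    obtain ⟨h1, h2⟩ := hS V hV
    rw [Finset.card_sdiff_of_subset, aux_filter_card, aux_filter_card, h1, hW]
    intro x hx
    simp only [Finset.mem_filter, Finset.mem_univ, true_and] at hx ⊢
    exact h2 hx
  have hb := Finset.card_biUnion hdisj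
  rw [Finset.sum_congr rfl hcard, Finset.sum_const, smul_eq_mul] at hb
  rw [← hb]
  have : S.biUnion f ⊆ Finset.univ \ (Finset.univ.filter (fun x => x ∈ W)) := by
    intro x hx
    simp only [f, Finset.mem_biUnion, Finset.mem_sdiff, Finset.mem_filter, Finset.mem_univ,
      true_and] at hx ⊢
    obtain ⟨_, _, _, h⟩ := hx
    exact h
  refine (Finset.card_le_card this).trans ?_
  rw [Finset.card_sdiff_of_subset (Finset.subset_univ _), aux_filter_card, hW]
  simp

/-- With `K = (q^{k−t+1} − 1)/(q − 1)`, the number of `(m+1)`-element sets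
`{V_1, …, V_{m+1}}` of `t`-dimensional subspaces of `F_q^k`, each containing `W`, with
`dim (V_1 + ⋯ + V_{m+1}) = m + t`, satisfies `|𝕏| ≤ K · q^{(k−m−t)m + (m+1)²}/(m+1)!`. -/
theorem stmt16 (q k m t : ℕ) (F : Type*) [Field F] [Fintype F] (hq : Fintype.card F = q)
    (hm : 1 ≤ m) (ht : 1 ≤ t) (hmtk : m + t ≤ k)
    (W : Submodule F (Fin k → F)) (hW : Module.finrank F ↥W = t - 1)
    (K : ℚ) (hK : K = ((q : ℚ) ^ (k - t + 1) - 1) / ((q : ℚ) - 1)) :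
    (Nat.card {X : Finset (Submodule F (Fin k → F)) //
        X.card = m + 1 ∧ (∀ V ∈ X, Module.finrank F ↥V = t ∧ W ≤ V) ∧
        Module.finrank F ↥(X.sup id) = m + t} : ℚ)
      ≤ K * (q : ℚ) ^ ((k - m - t) * m + (m + 1) ^ 2) / (Nat.factorial (m + 1) : ℚ) := by
  classical
  have hfin : Finite (Submodule F (Fin k → F)) := inferInstance
  haveI : Fintype (Submodule F (Fin k → F)) := Fintype.ofFinite _
  set S : Finset (Submodule F (Fin k → F)) :=
    Finset.univ.filter (fun V => Module.finrank F ↥V = t ∧ W ≤ V) with hSdef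
  have hcnt := aux_count F k t ht W hW S (by intro V hV; simpa [hSdef] using hV)
  rw [hq] at hcnt
  have hq2 : 2 ≤ q := hq ▸ Fintype.one_lt_card
  have hq2' : (2 : ℚ) ≤ q := by exact_mod_cast hq2
  have hq1 : (0 : ℚ) < (q : ℚ) - 1 := by linarith
  have hqp : (0 : ℚ) < (q : ℚ) ^ (t - 1) := by positivity
  -- the number of available subspaces
  have hSK : (S.card : ℚ) ≤ K := by
    have h1 : q ^ (t - 1) ≤ q ^ t := Nat.pow_le_pow_right (by omega) (by omega)
    have h2 : q ^ (t - 1) ≤ q ^ k := Nat.pow_le_pow_right (by omega) (by omega)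
    have hc : ((S.card * (q ^ t - q ^ (t - 1)) : ℕ) : ℚ) ≤ ((q ^ k - q ^ (t - 1) : ℕ) : ℚ) := by
      exact_mod_cast hcnt
    push_cast [Nat.cast_sub h1, Nat.cast_sub h2] at hc
    have e1 : (q : ℚ) ^ t = q ^ (t - 1) * q := by
      rw [← pow_succ]; congr 1; omega
    have e2 : (q : ℚ) ^ k = q ^ (t - 1) * q ^ (k - t + 1) := by
      rw [← pow_add]; congr 1; omega
    rw [e1, e2] at hc
    rw [hK, le_div_iff₀ hq1]
    refine le_of_mul_le_mul_left ?_ hqp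
    linarith
  have hKle : K ≤ (q : ℚ) ^ (k - t + 1) := by
    rw [hK, div_le_iff₀ hq1]
    have : (0 : ℚ) < (q : ℚ) ^ (k - t + 1) := by positivity
    nlinarith
  have hK0 : 0 ≤ K := le_trans (by positivity) hSK
  have hX : Nat.card {X : Finset (Submodule F (Fin k → F)) //
        X.card = m + 1 ∧ (∀ V ∈ X, Module.finrank F ↥V = t ∧ W ≤ V) ∧
        Module.finrank F ↥(X.sup id) = m + t} ≤ S.card.choose (m + 1) := by
    rw [← Finset.card_powersetCard, Nat.card_eq_fintype_card, Fintype.card_subtype]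
    apply Finset.card_le_card
    intro X hX
    simp only [Finset.mem_filter, Finset.mem_univ, true_and] at hX
    rw [Finset.mem_powersetCard]
    refine ⟨fun V hV => ?_, hX.1⟩
    simpa [hSdef] using hX.2.1 V hV
  have hX' : (Nat.card {X : Finset (Submodule F (Fin k → F)) //
        X.card = m + 1 ∧ (∀ V ∈ X, Module.finrank F ↥V = t ∧ W ≤ V) ∧
        Module.finrank F ↥(X.sup id) = m + t} : ℚ) ≤ (S.card.choose (m + 1) : ℕ) := by
    exact_mod_cast hX
  refine hX'.trans ((Nat.choose_le_pow_div (m + 1) S.card).trans ?_)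
  gcongr
  calc (S.card : ℚ) ^ (m + 1) ≤ K ^ (m + 1) := by gcongr
    _ = K * K ^ m := by ring
    _ ≤ K * ((q : ℚ) ^ (k - t + 1)) ^ m := by gcongr
    _ ≤ K * (q : ℚ) ^ ((k - m - t) * m + (m + 1) ^ 2) := by
      rw [← pow_mul]
      refine mul_le_mul_of_nonneg_left (pow_le_pow_right₀ (by linarith) ?_) hK0
      obtain ⟨d, rfl⟩ := Nat.exists_eq_add_of_le hmtk
      have a1 : m + t + d - t + 1 = m + d + 1 := by omega
      have a2 : m + t + d - m - t = d := by omega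
      rw [a1, a2]
      nlinarith
end

section
/- Let K, D be positive integers and let L be a simple graph with K·D vertices. Then L is isomorphic to the line graph of some D-left-regular bipartite graph with K left vertices if and only if the following conditions hold: (1) the vertex set of L can be partitioned into K disjoint cliques U_1, …, U_K, each containing exactly D vertices (the user-cliques); (2) for any two distinct user-cliques U_i, U_j and any vertex v ∈ U_i, there exists at most one vertex w ∈ U_j such that {v, w} is an edge of L; and (3) for every user-clique U_i and every vertex v ∈ U_i, the set {v} ∪ (N(v) \ U_i), consisting of v together with all neighbors of v outside U_i, is a clique of L. -/
/-- The line graph of the bipartite graph with left vertices `α`, right vertices `β`, and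
left-neighborhoods `N : α → Finset β`: its vertices are the edges `(a, b)` with `b ∈ N a`,
two distinct vertices being adjacent iff the corresponding edges share an endpoint. -/
def lineGraphOfBipartite {α β : Type*} (N : α → Finset β) :
    SimpleGraph {p : α × β // p.2 ∈ N p.1} where
  Adj e f := e ≠ f ∧ ((e : α × β).1 = (f : α × β).1 ∨ (e : α × β).2 = (f : α × β).2)
  symm := ⟨fun _ _ ⟨h1, h2⟩ => ⟨h1.symm, h2.imp Eq.symm Eq.symm⟩⟩
  loopless := ⟨fun _ h => h.1 rfl⟩

/-- A simple graph `L` on `K·D` vertices (`K, D ≥ 1`) is isomorphic to the line graph of a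
`D`-left-regular bipartite graph with `K` left vertices iff: (1) its vertex set can be
partitioned into `K` cliques `U_1, …, U_K` of `D` vertices each; (2) for distinct
user-cliques `U_i, U_j` and `v ∈ U_i` there is at most one `w ∈ U_j` adjacent to `v`;
(3) for every `U_i` and `v ∈ U_i`, the set `{v} ∪ (N(v) \ U_i)` is a clique. -/
theorem stmt17 {V : Type} [Fintype V] (K D : ℕ) (hK : 0 < K) (hD : 0 < D)
    (L : SimpleGraph V) (hcard : Fintype.card V = K * D) :
    (∃ (α β : Type) (inst : Fintype α) (N : α → Finset β),
        @Fintype.card α inst = K ∧ (∀ a : α, (N a).card = D) ∧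
        Nonempty (L ≃g lineGraphOfBipartite N)) ↔
      ∃ U : Fin K → Finset V,
        (∀ v : V, ∃! i : Fin K, v ∈ U i) ∧
        (∀ i, (U i).card = D) ∧
        (∀ i, L.IsClique (U i : Set V)) ∧
        (∀ i j, i ≠ j → ∀ v ∈ U i, ∀ w₁ ∈ U j, ∀ w₂ ∈ U j,
          L.Adj v w₁ → L.Adj v w₂ → w₁ = w₂) ∧
        (∀ i, ∀ v ∈ U i, L.IsClique ({v} ∪ (L.neighborSet v \ (U i : Set V)))) := by
  classical
  constructor
  · rintro ⟨α, β, inst, N, hα, hN, ⟨f⟩⟩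
    let e : Fin K ≃ α := (Fintype.equivFinOfCardEq hα).symm
    have hadj : ∀ v w, L.Adj v w ↔ (v ≠ w ∧ ((f v).1.1 = (f w).1.1 ∨ (f v).1.2 = (f w).1.2)) := by
      intro v w
      rw [← f.map_adj_iff]
      change (f v ≠ f w ∧ _) ↔ _
      rw [f.injective.ne_iff]
    have hext : ∀ v w, (f v).1.1 = (f w).1.1 → (f v).1.2 = (f w).1.2 → v = w := by
      intro v w h1 h2
      exact f.injective (Subtype.ext (Prod.ext h1 h2))
    have hmem : ∀ i v, v ∈ (Finset.univ.filter fun v => (f v).1.1 = e i) ↔ (f v).1.1 = e i := by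
      intro i v; simp
    refine ⟨fun i => Finset.univ.filter fun v => (f v).1.1 = e i, ?_, ?_, ?_, ?_, ?_⟩
    · intro v
      refine ⟨e.symm (f v).1.1, by simp, ?_⟩
      intro j hj
      simp only [hmem] at hj
      simp [hj]
    · intro i
      rw [← hN (e i)]
      refine Finset.card_bij (fun v _ => (f v).1.2) ?_ ?_ ?_
      · intro v hv
        rw [hmem] at hv
        rw [← hv]
        exact (f v).2
      · intro v hv w hw h
        rw [hmem] at hv hw
        exact hext v w (hv.trans hw.symm) h
      · intro b hb
        refine ⟨f.symm ⟨(e i, b), hb⟩, ?_, ?_⟩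
        · rw [hmem]; simp
        · simp
    · intro i v hv w hw hne
      simp only [Finset.mem_coe, hmem] at hv hw
      exact (hadj v w).2 ⟨hne, Or.inl (hv.trans hw.symm)⟩
    · intro i j hij v hv w₁ h₁ w₂ h₂ a₁ a₂
      rw [hmem] at hv h₁ h₂
      have hne : e i ≠ e j := e.injective.ne hij
      rw [hadj] at a₁ a₂
      grind
    · intro i v hv
      rw [hmem] at hv
      have key : ∀ w ∈ ({v} ∪ (L.neighborSet v \ ((Finset.univ.filter fun v => (f v).1.1 = e i : Finset V) : Set V))), (f w).1.2 = (f v).1.2 := by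
        rintro w (hw | ⟨hw, hw'⟩)
        · rw [Set.mem_singleton_iff.1 hw]
        · rw [SimpleGraph.mem_neighborSet, hadj] at hw
          rw [Finset.mem_coe, hmem] at hw'
          grind
      intro w hw x hx hne
      exact (hadj w x).2 ⟨hne, Or.inr ((key w hw).trans (key x hx).symm)⟩
  · rintro ⟨U, hU, hc, hcl, h2, h3⟩
    choose u hu huu using hU
    have hu' : ∀ v i, v ∈ U i → i = u v := fun v i h => huu v i h
    let S : Setoid V :=
      { r := fun v w => v = w ∨ (L.Adj v w ∧ u v ≠ u w)
        iseqv := by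
          refine ⟨fun _ => Or.inl rfl, ?_, ?_⟩
          · rintro v w (h | ⟨h, h'⟩)
            · exact Or.inl h.symm
            · exact Or.inr ⟨h.symm, h'.symm⟩
          · rintro v w x (rfl | ⟨h, h'⟩) (rfl | ⟨k, k'⟩)
            · exact Or.inl rfl
            · exact Or.inr ⟨k, k'⟩
            · exact Or.inr ⟨h, h'⟩
            · by_cases hvx : v = x
              · exact Or.inl hvx
              · refine Or.inr ⟨?_, ?_⟩
                · refine h3 (u w) w (hu w) (Or.inr ⟨h.symm, fun hh => ?_⟩)
                    (Or.inr ⟨k, fun hh => ?_⟩) hvx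
                  · exact h' (hu' _ _ hh).symm
                  · exact k' (hu' _ _ hh)
                · intro huvx
                  exact hvx (h2 (u w) (u v) h'.symm w (hu w) v (hu v) x (huvx ▸ hu x) h.symm k) }
    have hr : ∀ v w, (Quotient.mk S v = Quotient.mk S w) ↔ (v = w ∨ (L.Adj v w ∧ u v ≠ u w)) :=
      fun v w => Quotient.eq
    let N : Fin K → Finset (Quotient S) := fun i => (U i).image (Quotient.mk S)
    have hin : ∀ v w, u v = u w → Quotient.mk S v = Quotient.mk S w → v = w := by
      intro v w h h'
      rcases (hr v w).1 h' with h' | h'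
      · exact h'
      · exact absurd h h'.2
    let g : V → {p : Fin K × Quotient S // p.2 ∈ N p.1} := fun v =>
      ⟨(u v, Quotient.mk S v), Finset.mem_image_of_mem _ (hu v)⟩
    have hg : Function.Bijective g := by
      constructor
      · intro v w h
        have h' := congrArg Subtype.val h
        exact hin v w (congrArg Prod.fst h') (congrArg Prod.snd h')
      · rintro ⟨⟨i, b⟩, hb⟩
        obtain ⟨v, hv, hvb⟩ := Finset.mem_image.1 hb
        exact ⟨v, Subtype.ext (Prod.ext (hu' v i hv).symm hvb)⟩
    refine ⟨Fin K, Quotient S, inferInstance, N, Fintype.card_fin K, ?_,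
      ⟨⟨Equiv.ofBijective g hg, ?_⟩⟩⟩
    · intro i
      rw [← hc i]
      refine Finset.card_image_of_injOn ?_
      intro v hv w hw h
      exact hin v w ((hu' v i hv).symm.trans (hu' w i hw)) h
    · intro v w
      change (g v ≠ g w ∧ (u v = u w ∨ Quotient.mk S v = Quotient.mk S w)) ↔ L.Adj v w
      rw [hg.1.ne_iff, hr]
      constructor
      · rintro ⟨hne, h | h | h⟩
        · exact hcl (u v) (hu v) (h ▸ hu w) hne
        · exact absurd h hne
        · exact h.1
      · intro h
        refine ⟨h.ne, ?_⟩
        by_cases huv : u v = u w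
        · exact Or.inl huv
        · exact Or.inr (Or.inr ⟨h, huv⟩)
end
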